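/- Let n ≥ 4 be an integer and p a prime. The degree of the diagonal matrix diag(1, p, …, p, p²) (with n−2 middle entries equal to p) equals p·(p^{n−1}−1)·(p^n−1)/(p−1)². -/

import Mathlib

open Matrix

/-- `Λ_n = GL_n(ℤ)` viewed inside the `n × n` rational matrices: the matrices with integer
entries whose determinant is `±1`. -/
def Lambda (n : ℕ) : Set (Matrix (Fin n) (Fin n) ℚ) :=
  {γ | (∀ i j, ∃ z : ℤ, γ i j = (z : ℚ)) ∧ (γ.det = 1 ∨ γ.det = -1)}

/-- The right coset `Λ_n h = {γ * h : γ ∈ Λ_n}`. -/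
def rightCoset (n : ℕ) (h : Matrix (Fin n) (Fin n) ℚ) : Set (Matrix (Fin n) (Fin n) ℚ) :=
  {m | ∃ γ ∈ Lambda n, m = γ * h}

/-- The double coset `Λ_n g Λ_n = {γ₁ * g * γ₂ : γ₁, γ₂ ∈ Λ_n}`. -/
def doubleCoset (n : ℕ) (g : Matrix (Fin n) (Fin n) ℚ) : Set (Matrix (Fin n) (Fin n) ℚ) :=
  {m | ∃ γ₁ ∈ Lambda n, ∃ γ₂ ∈ Lambda n, m = γ₁ * g * γ₂}

/-- The degree of `g`: the number of distinct right cosets `Λ_n h` contained in `Λ_n g Λ_n`. -/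
noncomputable def degree (n : ℕ) (g : Matrix (Fin n) (Fin n) ℚ) : ℕ :=
  Set.ncard {S : Set (Matrix (Fin n) (Fin n) ℚ) | ∃ h ∈ doubleCoset n g, S = rightCoset n h}

/-- The `k`-th determinantal divisor of an `n × n` integer matrix: the gcd of all of its
`k × k` minors (which is `0` when all these minors vanish), a minor being indexed by a pair
of strictly increasing maps `Fin k → Fin n` selecting rows and columns. -/
def detDiv (n k : ℕ) (C : Matrix (Fin n) (Fin n) ℤ) : ℤ :=
  Finset.gcd ((Finset.univ : Finset ((Fin k → Fin n) × (Fin k → Fin n))).filter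
      (fun fg => (∀ a b : Fin k, a < b → fg.1 a < fg.1 b) ∧
        (∀ a b : Fin k, a < b → fg.2 a < fg.2 b)))
    (fun fg => (C.submatrix fg.1 fg.2).det)

/-- `D^(n)(p) = diag(1, p, …, p, p²)` with `n - 2` middle diagonal entries equal to `p`. -/
def Dmat (n p : ℕ) : Matrix (Fin n) (Fin n) ℤ :=
  Matrix.diagonal (fun i => if i.val = 0 then 1 else if i.val = n - 1 then (p : ℤ) ^ 2 else (p : ℤ))

/-- The set `R₀^(n)(p)` of upper-triangular integer matrices whose determinantal divisors are
`d_k = p^(k-1)` for `1 ≤ k ≤ n - 1` and `d_n = p^n`, whose diagonal entries all equal `p`, and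
whose above-diagonal entries lie in `[0, p)`. -/
def R0 (n p : ℕ) : Set (Matrix (Fin n) (Fin n) ℤ) :=
  {C | (∀ i j : Fin n, j < i → C i j = 0) ∧
    (∀ k : ℕ, 1 ≤ k → k ≤ n - 1 → detDiv n k C = (p : ℤ) ^ (k - 1)) ∧
    detDiv n n C = (p : ℤ) ^ n ∧
    (∀ i : Fin n, C i i = (p : ℤ)) ∧
    (∀ i j : Fin n, i < j → 0 ≤ C i j ∧ C i j < (p : ℤ))}

/-- The set `R₁^(n)(p)` of upper-triangular integer matrices whose diagonal entries lie in
`{1, p, p²}` with exactly one entry `1` and exactly one entry `p²`, whose above-diagonal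
entries satisfy `0 ≤ c i j < c j j`, and such that `p ∣ c i i` implies `p ∣ c i j` for `j > i`. -/
def R1 (n p : ℕ) : Set (Matrix (Fin n) (Fin n) ℤ) :=
  {C | (∀ i j : Fin n, j < i → C i j = 0) ∧
    (∀ i : Fin n, C i i = 1 ∨ C i i = (p : ℤ) ∨ C i i = (p : ℤ) ^ 2) ∧
    (∃! i : Fin n, C i i = 1) ∧
    (∃! i : Fin n, C i i = (p : ℤ) ^ 2) ∧
    (∀ i j : Fin n, i < j → 0 ≤ C i j ∧ C i j < C j j) ∧
    (∀ i j : Fin n, i < j → (p : ℤ) ∣ C i i → (p : ℤ) ∣ C i j)}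

/-- Casting an integer matrix to a rational matrix. -/
def toQ (n : ℕ) (C : Matrix (Fin n) (Fin n) ℤ) : Matrix (Fin n) (Fin n) ℚ :=
  C.map (fun z : ℤ => (z : ℚ))


section ZModSq

variable {p : ℕ}

lemma ZMod.isUnit_iff_prime_mul_ne_zero (hp : p.Prime) (r : ZMod (p ^ 2)) :
    IsUnit r ↔ (p : ZMod (p ^ 2)) * r ≠ 0 := by
  have : NeZero (p ^ 2) := ⟨pow_ne_zero 2 hp.ne_zero⟩
  obtain ⟨k, rfl⟩ : ∃ k : ℕ, (k : ZMod (p ^ 2)) = r := ⟨r.val, ZMod.natCast_zmod_val r⟩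
  rw [ZMod.isUnit_iff_coprime, Nat.coprime_pow_right_iff two_pos, Nat.coprime_comm,
    hp.coprime_iff_not_dvd, ← Nat.cast_mul, Ne, ZMod.natCast_eq_zero_iff, sq,
    Nat.mul_dvd_mul_iff_left hp.pos]

lemma ZMod.prime_mul_intCast_eq_zero (hp : p.Prime) (z : ℤ) :
    (p : ZMod (p ^ 2)) * (z : ZMod (p ^ 2)) = 0 ↔ (p : ℤ) ∣ z := by
  have : (p : ZMod (p ^ 2)) * (z : ZMod (p ^ 2)) = ((p * z : ℤ) : ZMod (p ^ 2)) := by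
    push_cast; rfl
  rw [this, ZMod.intCast_zmod_eq_zero_iff_dvd, Nat.cast_pow, sq]
  exact mul_dvd_mul_iff_left (by exact_mod_cast hp.ne_zero)

lemma ZMod.prime_mul_prime : (p : ZMod (p ^ 2)) * (p : ZMod (p ^ 2)) = 0 := by
  rw [← sq, ← Nat.cast_pow, ZMod.natCast_self]

lemma ZMod.mul_eq_zero_of_prime_mul_eq_zero (hp : p.Prime) {r s : ZMod (p ^ 2)}
    (hr : (p : ZMod (p ^ 2)) * r = 0) (hs : (p : ZMod (p ^ 2)) * s = 0) : r * s = 0 := by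
  obtain ⟨k, rfl⟩ := ZMod.intCast_surjective r
  obtain ⟨l, rfl⟩ := ZMod.intCast_surjective s
  rw [ZMod.prime_mul_intCast_eq_zero hp] at hr hs
  obtain ⟨a, rfl⟩ := hr
  obtain ⟨b, rfl⟩ := hs
  push_cast
  linear_combination (a : ZMod (p ^ 2)) * b * (ZMod.prime_mul_prime (p := p))

variable [NeZero (p ^ 2)]

lemma ZMod.card_filter_isUnit (hp : p.Prime) :
    (Finset.univ.filter fun r : ZMod (p ^ 2) => (p : ZMod (p ^ 2)) * r ≠ 0).card =
      p * (p - 1) := by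
  have h := ZMod.card_units_eq_totient (p ^ 2)
  rw [Nat.totient_prime_pow hp two_pos] at h
  rw [show p * (p - 1) = p ^ (2 - 1) * (p - 1) by simp, ← h, ← Finset.card_univ]
  symm
  refine Finset.card_bij (fun u _ => (u : ZMod (p ^ 2))) ?_ ?_ ?_
  · intro u _
    simpa using (ZMod.isUnit_iff_prime_mul_ne_zero hp _).1 u.isUnit
  · intro u _ w _ huw
    exact Units.ext huw
  · intro r hr
    obtain ⟨u, hu⟩ := (ZMod.isUnit_iff_prime_mul_ne_zero hp r).2 (Finset.mem_filter.1 hr).2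
    exact ⟨u, Finset.mem_univ _, hu⟩

lemma ZMod.card_filter_prime_mul_eq_zero (hp : p.Prime) :
    (Finset.univ.filter fun r : ZMod (p ^ 2) => (p : ZMod (p ^ 2)) * r = 0).card = p := by
  have h := Finset.card_filter_add_card_filter_not (s := (Finset.univ : Finset (ZMod (p ^ 2))))
    (fun r => (p : ZMod (p ^ 2)) * r = 0)
  rw [Finset.card_univ, ZMod.card, ZMod.card_filter_isUnit hp] at h
  obtain ⟨q, rfl⟩ : ∃ q, p = q + 1 := ⟨p - 1, by have := hp.pos; omega⟩
  simp only [Nat.add_sub_cancel] at h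
  nlinarith

end ZModSq

/-- The number of vectors over `ℤ/p²` in `m` variables that do not vanish modulo `p`. -/
lemma card_primitive {p : ℕ} [NeZero (p ^ 2)] (hp : p.Prime) (m : ℕ) :
    ((Finset.univ.filter fun v : Fin m → ZMod (p ^ 2) => (p : ZMod (p ^ 2)) • v ≠ 0).card : ℤ) =
      p ^ (2 * m) - p ^ m := by
  have h := Finset.card_filter_add_card_filter_not
    (s := (Finset.univ : Finset (Fin m → ZMod (p ^ 2)))) (fun v => (p : ZMod (p ^ 2)) • v = 0)
  have h0 : (Finset.univ.filter fun v : Fin m → ZMod (p ^ 2) => (p : ZMod (p ^ 2)) • v = 0) =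
      Fintype.piFinset fun _ =>
        Finset.univ.filter fun r : ZMod (p ^ 2) => (p : ZMod (p ^ 2)) * r = 0 := by
    ext v
    simp [funext_iff]
  rw [h0, Fintype.card_piFinset, Finset.prod_const, ZMod.card_filter_prime_mul_eq_zero hp,
    Finset.card_univ, Finset.card_univ, Fintype.card_fin, Fintype.card_fun, ZMod.card,
    Fintype.card_fin, ← pow_mul] at h
  zify at h
  linarith

/-- The number of primitive vectors over `ℤ/p²` orthogonal to a given primitive vector. -/
lemma card_primitive_orthogonal {p : ℕ} [NeZero (p ^ 2)] (hp : p.Prime) (m : ℕ)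
    (v : Fin (m + 1) → ZMod (p ^ 2)) (hv : (p : ZMod (p ^ 2)) • v ≠ 0) :
    (Finset.univ.filter fun φ : Fin (m + 1) → ZMod (p ^ 2) =>
        (p : ZMod (p ^ 2)) • φ ≠ 0 ∧ v ⬝ᵥ φ = 0).card =
      (Finset.univ.filter fun ψ : Fin m → ZMod (p ^ 2) => (p : ZMod (p ^ 2)) • ψ ≠ 0).card := by
  obtain ⟨i, hi⟩ := Function.ne_iff.1 hv
  obtain ⟨u, hu⟩ := (ZMod.isUnit_iff_prime_mul_ne_zero hp (v i)).2 hi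
  have hui : (↑u⁻¹ : ZMod (p ^ 2)) * v i = 1 := by rw [← hu, Units.inv_mul]
  refine Finset.card_bij' (fun φ _ => i.removeNth φ)
    (fun ψ _ => i.insertNth (-(↑u⁻¹ * ((i.removeNth v) ⬝ᵥ ψ))) ψ) ?_ ?_ ?_ ?_
  · intro φ hφ
    simp only [Finset.mem_filter, Finset.mem_univ, true_and] at hφ ⊢
    intro h0
    apply hφ.1
    have hs : ∀ j, (p : ZMod (p ^ 2)) * φ (i.succAbove j) = 0 := fun j => congrFun h0 j
    have hd := hφ.2
    rw [dotProduct, Fin.sum_univ_succAbove _ i] at hd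
    have hz : (p : ZMod (p ^ 2)) * ∑ j, v (i.succAbove j) * φ (i.succAbove j) = 0 := by
      rw [Finset.mul_sum]
      exact Finset.sum_eq_zero fun j _ => by rw [mul_left_comm, hs, mul_zero]
    funext k
    rcases Fin.eq_self_or_eq_succAbove i k with rfl | ⟨j, rfl⟩
    · simp only [Pi.smul_apply, smul_eq_mul, Pi.zero_apply]
      linear_combination (p : ZMod (p ^ 2)) * (↑u⁻¹ : ZMod (p ^ 2)) * hd -
        (↑u⁻¹ : ZMod (p ^ 2)) * hz - (p : ZMod (p ^ 2)) * φ k * hui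
    · exact hs j
  · intro ψ hψ
    simp only [Finset.mem_filter, Finset.mem_univ, true_and] at hψ ⊢
    constructor
    · intro h0
      apply hψ
      funext j
      simpa using congrFun h0 (i.succAbove j)
    · rw [dotProduct, Fin.sum_univ_succAbove _ i]
      simp only [Fin.insertNth_apply_same, Fin.insertNth_apply_succAbove]
      change _ + (i.removeNth v) ⬝ᵥ ψ = 0
      linear_combination -((i.removeNth v) ⬝ᵥ ψ) * hui
  · intro φ hφ
    simp only [Finset.mem_filter, Finset.mem_univ, true_and] at hφ
    have hd := hφ.2
    rw [dotProduct, Fin.sum_univ_succAbove _ i] at hd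
    change _ + (i.removeNth v) ⬝ᵥ (i.removeNth φ) = 0 at hd
    have : -(↑u⁻¹ * ((i.removeNth v) ⬝ᵥ (i.removeNth φ))) = φ i := by
      linear_combination -(↑u⁻¹ : ZMod (p ^ 2)) * hd + φ i * hui
    simp only [this, Fin.insertNth_self_removeNth]
  · intro ψ _
    simp

section FlagLattice

variable {ι : Type*} {p : ℕ}

/-- Reduction of an integer vector modulo `p²`. -/
def reduceVec (p : ℕ) (x : ι → ℤ) : ι → ZMod (p ^ 2) := fun i => (x i : ZMod (p ^ 2))

lemma reduceVec_add (x y : ι → ℤ) : reduceVec p (x + y) = reduceVec p x + reduceVec p y := by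
  ext; simp [reduceVec]

lemma reduceVec_sub (x y : ι → ℤ) : reduceVec p (x - y) = reduceVec p x - reduceVec p y := by
  ext; simp [reduceVec]

lemma reduceVec_smul (a : ℤ) (x : ι → ℤ) :
    reduceVec p (a • x) = (a : ZMod (p ^ 2)) • reduceVec p x := by
  ext; simp [reduceVec]

lemma reduceVec_surjective : Function.Surjective (reduceVec p : (ι → ℤ) → _) := fun v =>
  ⟨fun i => (ZMod.intCast_surjective (v i)).choose,
    funext fun i => (ZMod.intCast_surjective (v i)).choose_spec⟩

lemma prime_smul_reduceVec_eq_zero (hp : p.Prime) (x : ι → ℤ) :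
    (p : ZMod (p ^ 2)) • reduceVec p x = 0 ↔ ∀ i, (p : ℤ) ∣ x i := by
  simp only [funext_iff, Pi.smul_apply, smul_eq_mul, Pi.zero_apply, reduceVec,
    ZMod.prime_mul_intCast_eq_zero hp]

lemma reduceVec_single [DecidableEq ι] (i : ι) : reduceVec p (Pi.single i 1) = Pi.single i 1 := by
  funext j
  by_cases hj : j = i
  · subst hj; simp [reduceVec]
  · simp [reduceVec, hj]

/-- The vector `v` is a unit at `a`, zero at `b`, and zero modulo `p` at all other places. -/
def IsStandardAt [DecidableEq ι] (a b : ι) (v : ι → ZMod (p ^ 2)) : Prop :=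
  ∀ i, if i = a then (p : ZMod (p ^ 2)) * v i ≠ 0 else
    if i = b then v i = 0 else (p : ZMod (p ^ 2)) * v i = 0

lemma IsStandardAt.prime_smul_ne_zero [DecidableEq ι] {a b : ι} {v : ι → ZMod (p ^ 2)}
    (hv : IsStandardAt a b v) : (p : ZMod (p ^ 2)) • v ≠ 0 := by
  intro h
  have := hv a
  rw [if_pos rfl] at this
  exact this (congrFun h a)

lemma IsStandardAt.prime_mul_eq_zero [DecidableEq ι] {a b i : ι} {v : ι → ZMod (p ^ 2)}
    (hv : IsStandardAt a b v) (hi : i ≠ a) : (p : ZMod (p ^ 2)) * v i = 0 := by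
  have h := hv i
  rw [if_neg hi] at h
  split_ifs at h
  · rw [h, mul_zero]
  · exact h

lemma isStandardAt_of_prime_smul_ne_zero [DecidableEq ι] {a b : ι} {v : ι → ZMod (p ^ 2)}
    (hv : (p : ZMod (p ^ 2)) • v ≠ 0)
    (h : ∀ i, i ≠ a → if i = b then v i = 0 else (p : ZMod (p ^ 2)) * v i = 0) :
    IsStandardAt a b v := by
  intro i
  by_cases hi : i = a
  · subst hi
    rw [if_pos rfl]
    intro h0
    apply hv
    funext j
    by_cases hj : j = i
    · subst hj; exact h0
    · have := h j hj
      split_ifs at this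
      · simp [this]
      · exact this
  · rw [if_neg hi]
    exact h i hi

variable [Fintype ι]

/-- The integer vectors which modulo `p` are proportional to `v` and are orthogonal to `φ`
modulo `p²`. -/
def flagLattice (p : ℕ) (v φ : ι → ZMod (p ^ 2)) : Submodule ℤ (ι → ℤ) where
  carrier := {x | (∃ c : ZMod (p ^ 2), (p : ZMod (p ^ 2)) • reduceVec p x =
    c • (p : ZMod (p ^ 2)) • v) ∧ reduceVec p x ⬝ᵥ φ = 0}
  zero_mem' := by
    have h : reduceVec p (0 : ι → ℤ) = 0 := by ext; simp [reduceVec]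
    exact ⟨⟨0, by simp [h]⟩, by simp [h]⟩
  add_mem' := by
    rintro x y ⟨⟨c, hc⟩, hx⟩ ⟨⟨d, hd⟩, hy⟩
    exact ⟨⟨c + d, by rw [reduceVec_add, smul_add, hc, hd, add_smul]⟩, by
      rw [reduceVec_add, add_dotProduct, hx, hy, add_zero]⟩
  smul_mem' := by
    rintro a x ⟨⟨c, hc⟩, hx⟩
    exact ⟨⟨a * c, by rw [reduceVec_smul, smul_comm, hc, smul_smul]⟩, by
      rw [reduceVec_smul, smul_dotProduct, hx, smul_zero]⟩

lemma mem_flagLattice {v φ : ι → ZMod (p ^ 2)} {x : ι → ℤ} :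
    x ∈ flagLattice p v φ ↔
      (∃ c : ZMod (p ^ 2), (p : ZMod (p ^ 2)) • reduceVec p x = c • (p : ZMod (p ^ 2)) • v) ∧
        reduceVec p x ⬝ᵥ φ = 0 := Iff.rfl

lemma prime_sq_smul_mem_flagLattice (v φ : ι → ZMod (p ^ 2)) (x : ι → ℤ) :
    ((p : ℤ) ^ 2) • x ∈ flagLattice p v φ := by
  have h : reduceVec p (((p : ℤ) ^ 2) • x) = 0 := by
    rw [reduceVec_smul]
    rw [Int.cast_pow, Int.cast_natCast, pow_two (p : ZMod (p ^ 2)), ZMod.prime_mul_prime, zero_smul]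
  exact ⟨⟨0, by rw [h, smul_zero, zero_smul]⟩, by rw [h, zero_dotProduct]⟩

variable [DecidableEq ι]

/-- The elementary divisors `1, p, …, p, p²`, with `1` at `a` and `p²` at `b`. -/
def flagDivisor (p : ℕ) (a b i : ι) : ℤ := if i = a then 1 else if i = b then (p : ℤ) ^ 2 else p

lemma exists_basis_mem_iff_dvd (N : Submodule ℤ (ι → ℤ)) {m : ℤ} (hm : m ≠ 0)
    (hN : ∀ x, m • x ∈ N) :
    ∃ (b : Module.Basis ι ℤ (ι → ℤ)) (d : ι → ℤ), ∀ x, x ∈ N ↔ ∀ i, d i ∣ b.repr x i := by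
  have hr : Module.finrank ℤ N = Module.finrank ℤ (ι → ℤ) := by
    refine le_antisymm (Submodule.finrank_le N) ?_
    refine LinearMap.finrank_le_finrank_of_injective
      (f := (LinearMap.lsmul ℤ (ι → ℤ) m).codRestrict N hN) ?_
    intro x y hxy
    exact smul_right_injective _ hm (congrArg Subtype.val hxy)
  obtain ⟨b, d, bN, h⟩ := Submodule.exists_smith_normal_form_of_rank_eq (Pi.basisFun ℤ ι) hr
  refine ⟨b, d, fun x => ⟨fun hx i => ?_, fun hx => ?_⟩⟩
  · have hs := congrArg Subtype.val (bN.sum_repr ⟨x, hx⟩)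
    simp only [Submodule.coe_sum, Submodule.coe_smul, h] at hs
    refine ⟨bN.repr ⟨x, hx⟩ i, ?_⟩
    have := congrArg (fun y => b.repr y i) hs
    simp only [map_sum, map_smul, Finsupp.coe_finsetSum, Finset.sum_apply, Finsupp.smul_apply,
      Module.Basis.repr_self, Finsupp.single_apply, smul_eq_mul, mul_ite, mul_one, mul_zero,
      Finset.sum_ite_eq', Finset.mem_univ, if_true] at this
    rw [← this, mul_comm]
  · choose c hc using hx
    rw [← b.sum_repr x]
    refine Submodule.sum_mem _ fun i _ => ?_
    rw [hc, mul_comm, mul_smul, ← h]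
    exact Submodule.smul_mem _ _ (bN i).2

lemma exists_unit_vecMul (e : (ι → ℤ) ≃ₗ[ℤ] (ι → ℤ)) :
    ∃ γ : (Matrix ι ι ℤ)ˣ, ∀ x, x ᵥ* (γ : Matrix ι ι ℤ) = e x := by
  refine ⟨⟨(LinearMap.toMatrix' (e : (ι → ℤ) →ₗ[ℤ] (ι → ℤ)))ᵀ,
    (LinearMap.toMatrix' (e.symm : (ι → ℤ) →ₗ[ℤ] (ι → ℤ)))ᵀ, ?_, ?_⟩, fun x => ?_⟩
  · rw [← transpose_mul, ← LinearMap.toMatrix'_comp]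
    simp
  · rw [← transpose_mul, ← LinearMap.toMatrix'_comp]
    simp
  · rw [vecMul_transpose, LinearMap.toMatrix'_mulVec]
    rfl

/-- The lattice attached to a pair of orthogonal primitive vectors has elementary divisors
`1, p, …, p, p²`. -/
lemma exists_unit_mem_flagLattice_iff (hp : p.Prime) {a b : ι} (hab : a ≠ b)
    {v φ : ι → ZMod (p ^ 2)} (hv : (p : ZMod (p ^ 2)) • v ≠ 0)
    (hφ : (p : ZMod (p ^ 2)) • φ ≠ 0) (hvφ : v ⬝ᵥ φ = 0) :
    ∃ γ : (Matrix ι ι ℤ)ˣ, ∀ x, x ∈ flagLattice p v φ ↔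
      ∀ i, flagDivisor p a b i ∣ (x ᵥ* (γ : Matrix ι ι ℤ)) i := by
  have hp0 : (p : ℤ) ≠ 0 := by exact_mod_cast hp.ne_zero
  have hp1 : ¬ (p : ℤ) ∣ 1 := by
    intro h; exact hp.one_lt.ne' (by exact_mod_cast Int.eq_one_of_dvd_one (by positivity) h)
  have hp2 : ¬ (p : ℤ) ^ 2 ∣ p := by
    intro h
    rw [sq] at h
    exact hp1 (Int.dvd_of_mul_dvd_mul_left hp0 (by simpa using h))
  obtain ⟨e, d, hd⟩ := exists_basis_mem_iff_dvd (flagLattice p v φ) (pow_ne_zero 2 hp0)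
    (prime_sq_smul_mem_flagLattice v φ)
  have hsingle : ∀ (c : ℤ) i, c • e i ∈ flagLattice p v φ ↔ d i ∣ c := by
    intro c i
    simp only [hd, map_smul, Module.Basis.repr_self, Finsupp.smul_apply, smul_eq_mul]
    constructor
    · intro h
      simpa using h i
    · intro h j
      by_cases hj : i = j
      · subst hj; simpa using h
      · simp [Finsupp.single_eq_of_ne' hj]
  have hcase : ∀ i, (d i).natAbs = 1 ∨ (d i).natAbs = p ∨ (d i).natAbs = p ^ 2 := by
    intro i
    have h := (hsingle _ i).1 (prime_sq_smul_mem_flagLattice v φ (e i))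
    rw [← Int.natAbs_dvd_natAbs, Int.natAbs_pow, Int.natAbs_natCast,
      Nat.dvd_prime_pow hp] at h
    obtain ⟨k, hk, h⟩ := h
    interval_cases k <;> simp_all
  -- a basis vector is nonzero modulo `p`
  have hbasis : ∀ i j (s t : ℤ), i ≠ j → (∀ k, (p : ℤ) ∣ (s • e i - t • e j) k) → (p : ℤ) ∣ s := by
    intro i j s t hij h
    choose c hc using h
    have hx : s • e i - t • e j = (p : ℤ) • c := by
      funext k; simpa using hc k
    have := congrArg (fun x => e.repr x i) hx
    simp only [map_sub, map_smul, Module.Basis.repr_self, Finsupp.sub_apply, Finsupp.smul_apply,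
      Finsupp.single_eq_same, Finsupp.single_eq_of_ne hij, smul_eq_mul, mul_one, mul_zero,
      sub_zero] at this
    exact ⟨_, this⟩
  obtain ⟨i₀, hi₀⟩ : ∃ i, (d i).natAbs = 1 := by
    by_contra! hne
    apply hv
    obtain ⟨x, rfl⟩ := reduceVec_surjective v
    have hx : x ∈ flagLattice p (reduceVec p x) φ := ⟨⟨1, by simp⟩, hvφ⟩
    rw [prime_smul_reduceVec_eq_zero hp]
    have hdvd : ∀ i, (p : ℤ) ∣ e.repr x i := fun i => by
      refine dvd_trans ?_ ((hd x).1 hx i)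
      rw [← Int.dvd_natAbs]
      rcases hcase i with h | h | h
      · exact absurd h (hne i)
      · rw [h]
      · rw [h]; exact_mod_cast dvd_pow_self p two_ne_zero
    choose c hc using hdvd
    intro k
    rw [← e.sum_repr x, Finset.sum_apply]
    exact Finset.dvd_sum fun i _ => by
      rw [Pi.smul_apply, hc, smul_eq_mul, mul_assoc]; exact dvd_mul_right _ _
  have huniq₀ : ∀ i, (d i).natAbs = 1 → i = i₀ := by
    intro i hi
    by_contra hne
    have hmem : ∀ j, (d j).natAbs = 1 → e j ∈ flagLattice p v φ := fun j hj => by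
      rw [← one_smul ℤ (e j), hsingle, ← Int.natAbs_dvd, hj]; simp
    obtain ⟨⟨c, hc⟩, -⟩ := hmem i hi
    obtain ⟨⟨c', hc'⟩, -⟩ := hmem i₀ hi₀
    obtain ⟨s, rfl⟩ := ZMod.intCast_surjective c
    obtain ⟨t, rfl⟩ := ZMod.intCast_surjective c'
    have hz : ∀ k, (p : ℤ) ∣ (t • e i - s • e i₀) k := by
      rw [← prime_smul_reduceVec_eq_zero hp, reduceVec_sub, reduceVec_smul, reduceVec_smul,
        smul_sub, smul_comm (p : ZMod (p ^ 2)), hc, smul_comm (p : ZMod (p ^ 2)), hc',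
        smul_comm (t : ZMod (p ^ 2)), sub_self]
    have ht := hbasis i i₀ t s hne hz
    rw [← ZMod.prime_mul_intCast_eq_zero hp] at ht
    rw [smul_comm, smul_smul, ht, zero_smul, prime_smul_reduceVec_eq_zero hp] at hc'
    exact hp1 (hbasis i₀ i 1 0 (Ne.symm hne) (by simpa using hc'))
  have hpmem : ∀ i, (p : ℤ) • e i ∈ flagLattice p v φ ↔
      (p : ZMod (p ^ 2)) * (reduceVec p (e i) ⬝ᵥ φ) = 0 := by
    intro i
    rw [mem_flagLattice, reduceVec_smul]
    constructor
    · rintro ⟨-, h⟩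
      simpa using h
    · intro h
      refine ⟨⟨0, ?_⟩, by simpa using h⟩
      rw [smul_smul, Int.cast_natCast, ZMod.prime_mul_prime, zero_smul, zero_smul]
  obtain ⟨i₁, hi₁⟩ : ∃ i, (d i).natAbs = p ^ 2 := by
    by_contra! hne
    apply hφ
    have hdvd : ∀ i, (p : ZMod (p ^ 2)) * (reduceVec p (e i) ⬝ᵥ φ) = 0 := fun i => by
      rw [← hpmem, hsingle, ← Int.natAbs_dvd]
      rcases hcase i with h | h | h
      · simp [h]
      · rw [h]
      · exact absurd h (hne i)
    have hall : ∀ x : ι → ℤ, (p : ZMod (p ^ 2)) * (reduceVec p x ⬝ᵥ φ) = 0 := by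
      intro x
      have hx : x ∈ Submodule.span ℤ (Set.range e) := by rw [e.span_eq]; trivial
      induction hx using Submodule.span_induction with
      | zero => simp [reduceVec, dotProduct]
      | mem x hx => obtain ⟨i, rfl⟩ := hx; exact hdvd i
      | add x y _ _ hx hy => rw [reduceVec_add, add_dotProduct, mul_add, hx, hy, add_zero]
      | smul c x _ hx =>
        rw [reduceVec_smul, smul_dotProduct, smul_eq_mul, mul_left_comm, hx, mul_zero]
    funext k
    have hk := hall (Pi.single k 1)
    rw [reduceVec_single, single_one_dotProduct] at hk
    exact hk
  have huniq₁ : ∀ i, (d i).natAbs = p ^ 2 → i = i₁ := by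
    intro i hi
    by_contra hne
    obtain ⟨s, hs⟩ := ZMod.intCast_surjective (reduceVec p (e i) ⬝ᵥ φ)
    obtain ⟨t, ht⟩ := ZMod.intCast_surjective (reduceVec p (e i₁) ⬝ᵥ φ)
    have hmem : (p : ℤ) • (t • e i - s • e i₁) ∈ flagLattice p v φ := by
      rw [mem_flagLattice, reduceVec_smul, smul_dotProduct, reduceVec_sub, sub_dotProduct,
        reduceVec_smul, reduceVec_smul, smul_dotProduct, smul_dotProduct, ← hs, ← ht]
      refine ⟨⟨0, ?_⟩, ?_⟩
      · rw [smul_smul, Int.cast_natCast, ZMod.prime_mul_prime, zero_smul, zero_smul]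
      · simp only [smul_eq_mul]; ring
    have h := (hd _).1 hmem i
    rw [← Int.natAbs_dvd, hi] at h
    have h' : (p : ℤ) * p ∣ p * t := by
      simpa only [map_sub, map_smul, Module.Basis.repr_self, Finsupp.sub_apply,
        Finsupp.smul_apply, Finsupp.single_eq_same, Finsupp.single_eq_of_ne hne, smul_eq_mul,
        mul_one, mul_zero, sub_zero, sq, Nat.cast_mul] using h
    have hpt : (p : ℤ) ∣ t := Int.dvd_of_mul_dvd_mul_left hp0 h'
    rw [← ZMod.prime_mul_intCast_eq_zero hp, ht, ← hpmem, hsingle, ← Int.natAbs_dvd, hi₁] at hpt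
    exact hp2 (by exact_mod_cast hpt)
  have h01 : i₀ ≠ i₁ := by
    rintro rfl
    rw [hi₀] at hi₁
    exact (Nat.one_lt_pow two_ne_zero hp.one_lt).ne hi₁
  obtain ⟨σ, hσa, hσb⟩ : ∃ σ : Equiv.Perm ι, σ a = i₀ ∧ σ b = i₁ := by
    let τ := Equiv.swap a i₀
    refine ⟨τ.trans (Equiv.swap (τ b) i₁), ?_, ?_⟩
    · have : i₀ ≠ τ b := by
        intro h
        exact hab (τ.injective (by rw [← h]; simp [τ]))
      simp [τ, Equiv.swap_apply_of_ne_of_ne this h01]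
    · simp
  obtain ⟨γ, hγ⟩ := exists_unit_vecMul (e.reindex σ.symm).equivFun
  refine ⟨γ, fun x => ?_⟩
  have hdiv : ∀ i, flagDivisor p a b i = (d (σ i)).natAbs := by
    intro i
    unfold flagDivisor
    split_ifs with h h'
    · subst h; rw [hσa, hi₀]; rfl
    · subst h'; rw [hσb, hi₁]; push_cast; rfl
    · rcases hcase (σ i) with h1 | h1 | h1
      · exact absurd (σ.injective ((huniq₀ _ h1).trans hσa.symm)) h
      · rw [h1]
      · exact absurd (σ.injective ((huniq₁ _ h1).trans hσb.symm)) h'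
  rw [hd, hγ]
  simp only [hdiv, Int.natAbs_dvd, Module.Basis.equivFun_apply, Module.Basis.repr_reindex_apply,
    Equiv.symm_symm]
  exact (σ.forall_congr_right (q := fun i => d i ∣ e.repr x i)).symm

/-- A pair of orthogonal vectors over `ℤ/p²`, neither of which vanishes modulo `p`. -/
def IsFlagPair (v φ : ι → ZMod (p ^ 2)) : Prop :=
  (p : ZMod (p ^ 2)) • v ≠ 0 ∧ (p : ZMod (p ^ 2)) • φ ≠ 0 ∧ v ⬝ᵥ φ = 0

lemma prod_ite_ite_eq {a b : ι} (hab : a ≠ b) (A B C : ℕ) :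
    ∏ i : ι, (if i = a then A else if i = b then B else C) =
      A * B * C ^ (Fintype.card ι - 2) := by
  have h1 : b ∈ Finset.univ.erase a := by simp [hab.symm]
  rw [← Finset.mul_prod_erase _ _ (Finset.mem_univ a), ← Finset.mul_prod_erase _ _ h1,
    Finset.prod_congr (g := fun _ => C) rfl, Finset.prod_const, Finset.card_erase_of_mem h1,
    Finset.card_erase_of_mem (Finset.mem_univ a), Finset.card_univ]
  · simp [hab.symm, mul_assoc, Nat.sub_sub]
  · intro i hi
    simp only [Finset.mem_erase] at hi
    simp [hi.1, hi.2.1]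

open Classical in
lemma card_isStandardAt [NeZero (p ^ 2)] (hp : p.Prime) {a b : ι} (hab : a ≠ b) :
    (Finset.univ.filter fun v : ι → ZMod (p ^ 2) => IsStandardAt a b v).card =
      p * (p - 1) * p ^ (Fintype.card ι - 2) := by
  have h : (Finset.univ.filter fun v : ι → ZMod (p ^ 2) => IsStandardAt a b v) =
      Fintype.piFinset fun i => Finset.univ.filter fun r : ZMod (p ^ 2) =>
        if i = a then (p : ZMod (p ^ 2)) * r ≠ 0 else
          if i = b then r = 0 else (p : ZMod (p ^ 2)) * r = 0 := by
    ext v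
    simp [IsStandardAt]
  have h1 := prod_ite_ite_eq hab (p * (p - 1)) 1 p
  rw [mul_one] at h1
  rw [h, Fintype.card_piFinset, ← h1]
  refine Finset.prod_congr rfl fun i _ => ?_
  split_ifs with h1 h2
  · exact ZMod.card_filter_isUnit hp
  · rw [Finset.filter_eq' _ (0 : ZMod (p ^ 2))]; simp
  · exact ZMod.card_filter_prime_mul_eq_zero hp

lemma IsStandardAt.dotProduct_eq {a b : ι} (hp : p.Prime)
    {v φ : ι → ZMod (p ^ 2)} (hφ : IsStandardAt b a φ)
    (hv : ∀ i, i ≠ a → (p : ZMod (p ^ 2)) * v i = 0) : v ⬝ᵥ φ = v b * φ b := by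
  refine Finset.sum_eq_single b (fun i _ hi => ?_) (by simp)
  have h := hφ i
  rw [if_neg hi] at h
  split_ifs at h with hia
  · rw [h, mul_zero]
  · exact ZMod.mul_eq_zero_of_prime_mul_eq_zero hp (hv i hia) h

lemma IsStandardAt.isFlagPair {a b : ι} (hp : p.Prime) (hab : a ≠ b)
    {v φ : ι → ZMod (p ^ 2)} (hv : IsStandardAt a b v) (hφ : IsStandardAt b a φ) :
    IsFlagPair v φ := by
  refine ⟨hv.prime_smul_ne_zero, hφ.prime_smul_ne_zero, ?_⟩
  rw [hφ.dotProduct_eq hp]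
  · have h := hv b
    rw [if_neg hab.symm, if_pos rfl] at h
    rw [h, zero_mul]
  · exact fun i hi => hv.prime_mul_eq_zero hi

lemma IsStandardAt.mem_flagLattice_iff {a b : ι} (hp : p.Prime) (hab : a ≠ b)
    {v φ : ι → ZMod (p ^ 2)} (hv : IsStandardAt a b v) (hφ : IsStandardAt b a φ) (x : ι → ℤ) :
    x ∈ flagLattice p v φ ↔ ∀ i, flagDivisor p a b i ∣ x i := by
  have hva := hv a
  rw [if_pos rfl, ← ZMod.isUnit_iff_prime_mul_ne_zero hp] at hva
  have hφb := hφ b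
  rw [if_pos rfl, ← ZMod.isUnit_iff_prime_mul_ne_zero hp] at hφb
  have hsq : ∀ z : ℤ, (p : ℤ) ^ 2 ∣ z ↔ (z : ZMod (p ^ 2)) = 0 := fun z => by
    rw [ZMod.intCast_zmod_eq_zero_iff_dvd, Nat.cast_pow]
  rw [mem_flagLattice]
  constructor
  · rintro ⟨⟨c, hc⟩, hx⟩ i
    have hxi : ∀ i, i ≠ a → (p : ZMod (p ^ 2)) * reduceVec p x i = 0 := by
      intro i hi
      have h := congrFun hc i
      simp only [Pi.smul_apply, smul_eq_mul] at h
      rw [h, hv.prime_mul_eq_zero hi, mul_zero]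
    unfold flagDivisor
    split_ifs with h1 h2
    · exact one_dvd _
    · subst h2
      rw [hφ.dotProduct_eq hp hxi, hφb.mul_left_eq_zero] at hx
      exact (hsq _).2 hx
    · exact (ZMod.prime_mul_intCast_eq_zero hp _).1 (hxi i h1)
  · intro h
    have hxi : ∀ i, i ≠ a → (p : ZMod (p ^ 2)) * reduceVec p x i = 0 := by
      intro i hi
      refine (ZMod.prime_mul_intCast_eq_zero hp _).2 (dvd_trans ?_ (h i))
      unfold flagDivisor
      rw [if_neg hi]
      split_ifs
      · exact dvd_pow_self _ two_ne_zero
      · exact dvd_rfl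
    constructor
    · obtain ⟨u, hu⟩ := hva
      refine ⟨reduceVec p x a * ↑u⁻¹, funext fun i => ?_⟩
      simp only [Pi.smul_apply, smul_eq_mul]
      by_cases hi : i = a
      · subst hi
        rw [← hu, mul_left_comm, mul_assoc, Units.inv_mul, mul_one]
      · rw [hxi i hi, hv.prime_mul_eq_zero hi, mul_zero]
    · have hb := h b
      rw [flagDivisor, if_neg hab.symm, if_pos rfl, hsq] at hb
      rw [hφ.dotProduct_eq hp hxi, reduceVec, hb, zero_mul]

lemma IsFlagPair.isStandardAt {a b : ι} (hp : p.Prime)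
    {v φ : ι → ZMod (p ^ 2)} (h : IsFlagPair v φ)
    (hL : ∀ x, x ∈ flagLattice p v φ ↔ ∀ i, flagDivisor p a b i ∣ x i) :
    IsStandardAt a b v ∧ IsStandardAt b a φ := by
  obtain ⟨hv, hφ, hvφ⟩ := h
  have hva : ∀ i, i ≠ a → if i = b then v i = 0 else (p : ZMod (p ^ 2)) * v i = 0 := by
    intro i hi
    obtain ⟨x, rfl⟩ := reduceVec_surjective v
    have hx := (hL x).1 ⟨⟨1, by simp⟩, hvφ⟩ i
    rw [flagDivisor, if_neg hi] at hx
    split_ifs at hx ⊢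
    · rw [reduceVec, ZMod.intCast_zmod_eq_zero_iff_dvd, Nat.cast_pow]
      exact hx
    · exact (ZMod.prime_mul_intCast_eq_zero hp _).2 hx
  have hφb : ∀ i, i ≠ b → if i = a then φ i = 0 else (p : ZMod (p ^ 2)) * φ i = 0 := by
    intro i hi
    have hx := ((hL (flagDivisor p a b i • Pi.single i 1)).2 fun j => ?_).2
    · rw [reduceVec_smul, reduceVec_single, smul_dotProduct, single_one_dotProduct, flagDivisor,
        if_neg hi] at hx
      split_ifs at hx ⊢
      · simpa using hx
      · simpa using hx
    · by_cases hj : j = i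
      · subst hj; simp
      · simp [hj]
  exact ⟨isStandardAt_of_prime_smul_ne_zero hv hva, isStandardAt_of_prime_smul_ne_zero hφ hφb⟩

/-- Reduction modulo `p²` of an invertible integer matrix. -/
def reduceUnit (p : ℕ) (γ : (Matrix ι ι ℤ)ˣ) : (Matrix ι ι (ZMod (p ^ 2)))ˣ :=
  Units.map (Int.castRingHom (ZMod (p ^ 2))).mapMatrix.toMonoidHom γ

lemma reduceVec_vecMul (γ : (Matrix ι ι ℤ)ˣ) (x : ι → ℤ) :
    reduceVec p (x ᵥ* (γ : Matrix ι ι ℤ)) =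
      reduceVec p x ᵥ* (reduceUnit p γ : Matrix ι ι (ZMod (p ^ 2))) := by
  funext i
  exact RingHom.map_vecMul (Int.castRingHom (ZMod (p ^ 2))) (γ : Matrix ι ι ℤ) x i

lemma vecMul_mem_flagLattice_iff (γ : (Matrix ι ι ℤ)ˣ) (v φ : ι → ZMod (p ^ 2)) (x : ι → ℤ) :
    x ᵥ* (γ : Matrix ι ι ℤ) ∈ flagLattice p v φ ↔
      x ∈ flagLattice p (v ᵥ* (↑(reduceUnit p γ)⁻¹ : Matrix ι ι (ZMod (p ^ 2))))
        ((reduceUnit p γ : Matrix ι ι (ZMod (p ^ 2))) *ᵥ φ) := by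
  rw [mem_flagLattice, mem_flagLattice, reduceVec_vecMul, dotProduct_mulVec]
  refine and_congr_left fun _ => exists_congr fun c => ⟨fun h => ?_, fun h => ?_⟩
  · have := congrArg (· ᵥ* (↑(reduceUnit p γ)⁻¹ : Matrix ι ι (ZMod (p ^ 2)))) h
    simpa [smul_vecMul] using this
  · have := congrArg (· ᵥ* (reduceUnit p γ : Matrix ι ι (ZMod (p ^ 2)))) h
    simpa [smul_vecMul] using this

lemma IsFlagPair.transform {v φ : ι → ZMod (p ^ 2)} (h : IsFlagPair v φ)
    (u : (Matrix ι ι (ZMod (p ^ 2)))ˣ) :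
    IsFlagPair (v ᵥ* (↑u⁻¹ : Matrix ι ι (ZMod (p ^ 2))))
      ((u : Matrix ι ι (ZMod (p ^ 2))) *ᵥ φ) := by
  refine ⟨fun h0 => h.1 ?_, fun h0 => h.2.1 ?_, ?_⟩
  · have := congrArg (· ᵥ* (u : Matrix ι ι (ZMod (p ^ 2)))) h0
    simpa [← smul_vecMul] using this
  · have := congrArg ((↑u⁻¹ : Matrix ι ι (ZMod (p ^ 2))) *ᵥ ·) h0
    simpa [← mulVec_smul] using this
  · rw [dotProduct_mulVec, vecMul_vecMul, Units.inv_mul, vecMul_one, h.2.2]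

/-- The lattice of elementary divisors `1, p, …, p, p²` with respect to the basis of `ℤⁿ` in which
the coordinates of `x` are `x γ`. -/
def divisorLattice (p : ℕ) (a b : ι) (γ : (Matrix ι ι ℤ)ˣ) : Set (ι → ℤ) :=
  {x | ∀ i, flagDivisor p a b i ∣ (x ᵥ* (γ : Matrix ι ι ℤ)) i}

open Classical in
lemma card_flagPair_fiber [NeZero (p ^ 2)] (hp : p.Prime) {a b : ι} (hab : a ≠ b)
    (γ : (Matrix ι ι ℤ)ˣ) :
    ((Finset.univ.filter fun w : (ι → ZMod (p ^ 2)) × (ι → ZMod (p ^ 2)) =>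
        IsFlagPair w.1 w.2).filter fun w =>
          (flagLattice p w.1 w.2 : Set (ι → ℤ)) = divisorLattice p a b γ).card =
      (p * (p - 1) * p ^ (Fintype.card ι - 2)) ^ 2 := by
  have hstd := congrArg₂ (· * ·) (card_isStandardAt hp hab) (card_isStandardAt hp hab.symm)
  simp only [← Finset.card_product] at hstd
  rw [pow_two (_ * _), ← hstd]
  have hinv : reduceUnit p γ⁻¹ = (reduceUnit p γ)⁻¹ := map_inv _ _
  refine Finset.card_bij'
    (fun w _ => (w.1 ᵥ* (reduceUnit p γ : Matrix ι ι (ZMod (p ^ 2))),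
      (↑(reduceUnit p γ)⁻¹ : Matrix ι ι (ZMod (p ^ 2))) *ᵥ w.2))
    (fun w _ => (w.1 ᵥ* (↑(reduceUnit p γ)⁻¹ : Matrix ι ι (ZMod (p ^ 2))),
      (reduceUnit p γ : Matrix ι ι (ZMod (p ^ 2))) *ᵥ w.2)) ?_ ?_ ?_ ?_
  · rintro ⟨v, φ⟩ hw
    simp only [Finset.mem_filter, Finset.mem_univ, true_and, Finset.mem_product] at hw ⊢
    have ht := hw.1.transform (reduceUnit p γ)⁻¹
    rw [inv_inv] at ht
    refine ht.isStandardAt hp fun x => ?_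
    have hx := vecMul_mem_flagLattice_iff γ⁻¹ v φ x
    rw [hinv, inv_inv] at hx
    rw [← hx, ← SetLike.mem_coe, hw.2]
    simp [divisorLattice]
  · rintro ⟨v, φ⟩ hw
    simp only [Finset.mem_filter, Finset.mem_univ, true_and, Finset.mem_product] at hw ⊢
    refine ⟨(hw.1.isFlagPair hp hab hw.2).transform _, Set.ext fun x => ?_⟩
    rw [SetLike.mem_coe, ← vecMul_mem_flagLattice_iff, hw.1.mem_flagLattice_iff hp hab hw.2]
    rfl
  · rintro ⟨v, φ⟩ _
    simp
  · rintro ⟨v, φ⟩ _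
    simp

open Classical in
lemma card_flagPair_eq [NeZero (p ^ 2)] (hp : p.Prime) {a b : ι} (hab : a ≠ b) :
    (Finset.univ.filter fun w : (ι → ZMod (p ^ 2)) × (ι → ZMod (p ^ 2)) =>
        IsFlagPair w.1 w.2).card =
      (Set.range (divisorLattice p a b)).ncard *
        (p * (p - 1) * p ^ (Fintype.card ι - 2)) ^ 2 := by
  have himage : Set.range (divisorLattice p a b) =
      ((Finset.univ.filter fun w : (ι → ZMod (p ^ 2)) × (ι → ZMod (p ^ 2)) =>
        IsFlagPair w.1 w.2).image fun w => (flagLattice p w.1 w.2 : Set (ι → ℤ)) :) := by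
    ext S
    simp only [Set.mem_range, Finset.coe_image, Set.mem_image, Finset.mem_coe, Finset.mem_filter,
      Finset.mem_univ, true_and]
    constructor
    · rintro ⟨γ, rfl⟩
      have hpos : 0 < (p * (p - 1) * p ^ (Fintype.card ι - 2)) ^ 2 := by
        have := hp.pos
        have : 0 < p - 1 := Nat.sub_pos_of_lt hp.one_lt
        positivity
      rw [← card_flagPair_fiber hp hab γ, Finset.card_pos] at hpos
      obtain ⟨w, hw⟩ := hpos
      simp only [Finset.mem_filter, Finset.mem_univ, true_and] at hw
      exact ⟨w, hw⟩
    · rintro ⟨w, hw, rfl⟩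
      obtain ⟨γ, hγ⟩ := exists_unit_mem_flagLattice_iff hp hab hw.1 hw.2.1 hw.2.2
      exact ⟨γ, Set.ext fun x => (hγ x).symm⟩
  rw [Finset.card_eq_sum_card_image fun w => (flagLattice p w.1 w.2 : Set (ι → ℤ)),
    Finset.sum_const_nat, himage, Set.ncard_coe_finset]
  intro S hS
  rw [← Finset.mem_coe, ← himage] at hS
  obtain ⟨γ, rfl⟩ := hS
  exact card_flagPair_fiber hp hab γ

end FlagLattice

open Classical in
lemma card_flagPair {p : ℕ} [NeZero (p ^ 2)] (hp : p.Prime) (m : ℕ) :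
    ((Finset.univ.filter fun w : (Fin (m + 1) → ZMod (p ^ 2)) × (Fin (m + 1) → ZMod (p ^ 2)) =>
        IsFlagPair w.1 w.2).card : ℤ) =
      (p ^ (2 * (m + 1)) - p ^ (m + 1)) * (p ^ (2 * m) - p ^ m) := by
  rw [← card_primitive hp, ← card_primitive hp, ← Nat.cast_mul, Nat.cast_inj]
  have h := Finset.card_eq_sum_card_fiberwise (f := Prod.fst)
    (s := Finset.univ.filter fun w : (Fin (m + 1) → ZMod (p ^ 2)) × (Fin (m + 1) → ZMod (p ^ 2)) =>
      IsFlagPair w.1 w.2)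
    (t := Finset.univ.filter fun v : Fin (m + 1) → ZMod (p ^ 2) => (p : ZMod (p ^ 2)) • v ≠ 0)
    (by intro w hw; simpa using (by simpa using hw : IsFlagPair w.1 w.2).1)
  rw [h]
  refine Finset.sum_const_nat fun v hv => ?_
  have hv' := (Finset.mem_filter.1 hv).2
  rw [← card_primitive_orthogonal hp m v hv']
  refine Finset.card_bij' (fun w _ => w.2) (fun φ _ => (v, φ)) ?_ ?_ ?_ ?_
  · rintro ⟨v', φ⟩ hw
    simp only [Finset.mem_filter, Finset.mem_univ, true_and] at hw ⊢
    obtain ⟨hw, rfl⟩ := hw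
    exact hw.2
  · intro φ hφ
    simp only [Finset.mem_filter, Finset.mem_univ, true_and] at hφ ⊢
    exact ⟨⟨hv', hφ⟩, trivial⟩
  · rintro ⟨v', φ⟩ hw
    simp only [Finset.mem_filter] at hw
    simp [hw.2]
  · intro φ _
    rfl

section Cosets

variable {n : ℕ}

lemma toQ_mul (A B : Matrix (Fin n) (Fin n) ℤ) : toQ n (A * B) = toQ n A * toQ n B :=
  map_mul (Int.castRingHom ℚ).mapMatrix A B

lemma toQ_one : toQ n 1 = 1 := map_one (Int.castRingHom ℚ).mapMatrix

lemma toQ_injective : Function.Injective (toQ n) :=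
  Matrix.map_injective Int.cast_injective

lemma det_toQ (A : Matrix (Fin n) (Fin n) ℤ) : (toQ n A).det = (A.det : ℚ) :=
  ((Int.castRingHom ℚ).map_det A).symm

lemma mem_Lambda_iff {γ : Matrix (Fin n) (Fin n) ℚ} :
    γ ∈ Lambda n ↔ ∃ u : (Matrix (Fin n) (Fin n) ℤ)ˣ, γ = toQ n u := by
  constructor
  · rintro ⟨hint, hdet⟩
    choose z hz using hint
    have hγ : γ = toQ n (Matrix.of z) := by
      ext i j
      simp [toQ, hz]
    have hu : IsUnit (Matrix.of z) := by
      rw [Matrix.isUnit_iff_isUnit_det, Int.isUnit_iff]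
      rw [hγ, det_toQ] at hdet
      exact_mod_cast hdet
    exact ⟨hu.unit, hγ⟩
  · rintro ⟨u, rfl⟩
    refine ⟨fun i j => ⟨_, rfl⟩, ?_⟩
    rw [det_toQ]
    have h := (Matrix.isUnit_iff_isUnit_det _).1 u.isUnit
    rw [Int.isUnit_iff] at h
    exact_mod_cast h

lemma toQ_mem_rightCoset_iff {h h' : Matrix (Fin n) (Fin n) ℤ} :
    toQ n h ∈ rightCoset n (toQ n h') ↔ ∃ u : (Matrix (Fin n) (Fin n) ℤ)ˣ, h = u * h' := by
  constructor
  · rintro ⟨γ, hγ, hh⟩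
    obtain ⟨u, rfl⟩ := mem_Lambda_iff.1 hγ
    exact ⟨u, toQ_injective (by rw [hh, toQ_mul])⟩
  · rintro ⟨u, rfl⟩
    exact ⟨_, mem_Lambda_iff.2 ⟨u, rfl⟩, toQ_mul _ _⟩

lemma rightCoset_unit_mul (u : (Matrix (Fin n) (Fin n) ℤ)ˣ) (h : Matrix (Fin n) (Fin n) ℚ) :
    rightCoset n (toQ n u * h) = rightCoset n h := by
  ext m
  constructor
  · rintro ⟨γ, hγ, rfl⟩
    obtain ⟨w, rfl⟩ := mem_Lambda_iff.1 hγ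
    refine ⟨_, mem_Lambda_iff.2 ⟨w * u, rfl⟩, ?_⟩
    rw [Units.val_mul, toQ_mul, mul_assoc]
  · rintro ⟨γ, hγ, rfl⟩
    obtain ⟨w, rfl⟩ := mem_Lambda_iff.1 hγ
    refine ⟨_, mem_Lambda_iff.2 ⟨w * u⁻¹, rfl⟩, ?_⟩
    rw [← mul_assoc, ← toQ_mul, Units.val_mul, mul_assoc, Units.inv_mul, mul_one]

/-- The lattice spanned by the rows of an integer matrix. -/
def rowLattice (h : Matrix (Fin n) (Fin n) ℤ) : Set (Fin n → ℤ) := Set.range fun y => y ᵥ* h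

lemma exists_mul_of_rowLattice_subset {h h' : Matrix (Fin n) (Fin n) ℤ}
    (hs : rowLattice h ⊆ rowLattice h') : ∃ A, h = A * h' := by
  have hrow : ∀ i, ∃ y, y ᵥ* h' = h i := fun i =>
    hs ⟨Pi.single i 1, by simp; rfl⟩
  choose A hA using hrow
  refine ⟨Matrix.of A, ?_⟩
  ext i j
  rw [← hA i]
  rfl

/-- Right cosets of nonsingular integer matrices are classified by their row lattices. -/
lemma rightCoset_toQ_eq_iff {h h' : Matrix (Fin n) (Fin n) ℤ} (hdet : h.det ≠ 0) :
    rightCoset n (toQ n h) = rightCoset n (toQ n h') ↔ rowLattice h = rowLattice h' := by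
  constructor
  · intro he
    have hmem : toQ n h ∈ rightCoset n (toQ n h') := he ▸ toQ_mem_rightCoset_iff.2 ⟨1, by simp⟩
    obtain ⟨u, rfl⟩ := toQ_mem_rightCoset_iff.1 hmem
    ext x
    constructor
    · rintro ⟨y, rfl⟩
      exact ⟨y ᵥ* (u : Matrix (Fin n) (Fin n) ℤ), by simp [vecMul_vecMul]⟩
    · rintro ⟨y, rfl⟩
      exact ⟨y ᵥ* (↑u⁻¹ : Matrix (Fin n) (Fin n) ℤ), by simp [vecMul_vecMul, ← mul_assoc]⟩
  · intro he
    obtain ⟨A, hA⟩ := exists_mul_of_rowLattice_subset he.subset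
    obtain ⟨B, hB⟩ := exists_mul_of_rowLattice_subset he.symm.subset
    have hABh : (A * B) * h = 1 * h := by rw [mul_assoc, ← hB, ← hA, one_mul]
    have hAB : A * B = 1 := by
      have h2 := congrArg (· * h.adjugate) hABh
      simp only [mul_assoc, mul_adjugate, Matrix.mul_smul, mul_one, one_mul] at h2
      exact smul_right_injective _ hdet h2
    have hBA : B * A = 1 := mul_eq_one_comm.1 hAB
    have hu := rightCoset_unit_mul ⟨A, B, hAB, hBA⟩ (toQ n h')
    rw [← hu, hA, toQ_mul]

lemma ncard_range_eq_of_iff {α β γ : Type*} {f : α → β} {g : α → γ}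
    (h : ∀ x y, f x = f y ↔ g x = g y) : (Set.range f).ncard = (Set.range g).ncard := by
  have hk : Setoid.ker f = Setoid.ker g := Setoid.ext fun x y => h x y
  rw [← Nat.card_coe_set_eq, ← Nat.card_coe_set_eq,
    ← Nat.card_congr (Setoid.quotientKerEquivRange f), hk,
    Nat.card_congr (Setoid.quotientKerEquivRange g)]

lemma rowLattice_diagonal_mul_inv (p : ℕ) (a b : Fin n) (γ : (Matrix (Fin n) (Fin n) ℤ)ˣ) :
    rowLattice (Matrix.diagonal (flagDivisor p a b) * (↑γ⁻¹ : Matrix (Fin n) (Fin n) ℤ)) =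
      divisorLattice p a b γ := by
  ext x
  constructor
  · rintro ⟨y, rfl⟩ i
    simp [vecMul_vecMul, mul_assoc, vecMul_diagonal]
  · intro hx
    choose y hy using hx
    refine ⟨y, ?_⟩
    have : y ᵥ* Matrix.diagonal (flagDivisor p a b) = x ᵥ* (γ : Matrix (Fin n) (Fin n) ℤ) := by
      funext i
      rw [vecMul_diagonal, hy, mul_comm]
    simp only
    rw [← vecMul_vecMul, this, vecMul_vecMul, Units.mul_inv, vecMul_one]

lemma degree_toQ_diagonal {p : ℕ} (hp : p.Prime) (a b : Fin n) :
    degree n (toQ n (Matrix.diagonal (flagDivisor p a b))) =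
      (Set.range (divisorLattice p a b)).ncard := by
  have hset : {S | ∃ h ∈ doubleCoset n (toQ n (Matrix.diagonal (flagDivisor p a b))),
      S = rightCoset n h} = Set.range fun γ : (Matrix (Fin n) (Fin n) ℤ)ˣ => rightCoset n
        (toQ n (Matrix.diagonal (flagDivisor p a b) * (↑γ⁻¹ : Matrix (Fin n) (Fin n) ℤ))) := by
    ext S
    constructor
    · rintro ⟨h, ⟨γ₁, h₁, γ₂, h₂, rfl⟩, rfl⟩
      obtain ⟨u, rfl⟩ := mem_Lambda_iff.1 h₁
      obtain ⟨w, rfl⟩ := mem_Lambda_iff.1 h₂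
      refine ⟨w⁻¹, ?_⟩
      simp only [inv_inv]
      rw [mul_assoc, rightCoset_unit_mul, toQ_mul]
    · rintro ⟨γ, rfl⟩
      refine ⟨_, ⟨1, mem_Lambda_iff.2 ⟨1, toQ_one.symm⟩, _, mem_Lambda_iff.2 ⟨γ⁻¹, rfl⟩, rfl⟩, ?_⟩
      simp only
      rw [one_mul, toQ_mul]
  rw [degree, hset]
  refine ncard_range_eq_of_iff fun γ γ' => ?_
  rw [rightCoset_toQ_eq_iff, rowLattice_diagonal_mul_inv, rowLattice_diagonal_mul_inv]
  rw [det_mul, det_diagonal]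
  refine mul_ne_zero (Finset.prod_ne_zero_iff.2 fun i _ => ?_)
    ((Matrix.isUnit_iff_isUnit_det _).1 (γ⁻¹).isUnit).ne_zero
  unfold flagDivisor
  split_ifs <;> simp [hp.ne_zero]

end Cosets

theorem statement3 (n p : ℕ) (hn : 4 ≤ n) (hp : p.Prime) :
    (degree n (Matrix.diagonal fun i : Fin n =>
      if i.val = 0 then (1 : ℚ) else if i.val = n - 1 then (p : ℚ) ^ 2 else (p : ℚ)) : ℚ) =
      (p : ℚ) * ((p : ℚ) ^ (n - 1) - 1) * ((p : ℚ) ^ n - 1) / ((p : ℚ) - 1) ^ 2 := by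
  have : NeZero (p ^ 2) := ⟨pow_ne_zero 2 hp.ne_zero⟩
  obtain ⟨m, rfl⟩ : ∃ m, n = m + 1 + 1 := ⟨n - 2, by omega⟩
  have hab : (0 : Fin (m + 1 + 1)) ≠ Fin.last (m + 1) := (Fin.last_pos).ne
  have hdiag : (Matrix.diagonal fun i : Fin (m + 1 + 1) =>
      if i.val = 0 then (1 : ℚ) else if i.val = m + 1 + 1 - 1 then (p : ℚ) ^ 2 else (p : ℚ)) =
      toQ _ (Matrix.diagonal (flagDivisor p 0 (Fin.last (m + 1)))) := by
    rw [toQ, Matrix.diagonal_map Int.cast_zero]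
    congr 1
    funext i
    simp only [flagDivisor, Fin.ext_iff, Fin.val_zero, Fin.val_last, Nat.add_sub_cancel]
    split_ifs <;> simp
  have hcount := card_flagPair hp (m + 1)
  rw [card_flagPair_eq hp hab, ← degree_toQ_diagonal hp, ← hdiag, Fintype.card_fin] at hcount
  have hp1 : (p : ℚ) - 1 ≠ 0 := sub_ne_zero.2 (by exact_mod_cast hp.one_lt.ne')
  have hp0 : (p : ℚ) ≠ 0 := by exact_mod_cast hp.ne_zero
  have hq := congrArg (Int.cast : ℤ → ℚ) hcount
  push_cast [Nat.cast_sub hp.one_lt.le] at hq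
  simp only [Nat.add_sub_cancel] at hq ⊢
  rw [eq_div_iff (pow_ne_zero 2 hp1)]
  have hpm : ((p : ℚ) ^ (m + 1)) ^ 2 ≠ 0 := pow_ne_zero _ (pow_ne_zero _ hp0)
  apply mul_left_cancel₀ hpm
  calc _ = _ := by ring
    _ = _ := hq
    _ = _ := by ring
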